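/- For every α ∈ (0,1): E_splits[ M_in·Pᵀ·M_in·P·M_in ] = α³·P̂ᵀ·P̂ + (α²−α³)·(Ĉ·P̂ + P̂ᵀ·Ĉ) + (α²−α³)·diag(P̂ᵀ·P̂) + (α−3α²+2α³)·Ĉ², where P̂ = M_tr·P·M_tr and Ĉ = diag(P̂). -/

import Mathlib

open Matrix Finset

/-- Training mask matrix: diagonal, 1 on the first `m` nodes. -/
noncomputable def trainMask (n m : ℕ) : Matrix (Fin n) (Fin n) ℝ :=
  Matrix.diagonal fun i => if (i : ℕ) < m then 1 else 0

/-- Input mask matrix determined by Bernoulli draws `r : Fin m → Bool`. -/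
noncomputable def inMask (n m : ℕ) (r : Fin m → Bool) : Matrix (Fin n) (Fin n) ℝ :=
  Matrix.diagonal fun i => if h : (i : ℕ) < m then (if r ⟨i, h⟩ then 1 else 0) else 0

/-- Probability weight of a split `r` under iid Bernoulli(α). -/
noncomputable def splitWeight (m : ℕ) (α : ℝ) (r : Fin m → Bool) : ℝ :=
  ∏ i : Fin m, if r i then α else 1 - α

theorem split_moment (m : ℕ) (α : ℝ) (S : Finset (Fin m)) :
    ∑ r : Fin m → Bool, splitWeight m α r * ∏ i ∈ S, (if r i then (1 : ℝ) else 0)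
      = α ^ S.card := by
  have h := Finset.prod_univ_sum (fun _ : Fin m => (Finset.univ : Finset Bool))
    (fun i b => (if b then α else 1 - α) * (if i ∈ S then (if b then (1 : ℝ) else 0) else 1))
  rw [Fintype.piFinset_univ] at h
  have h2 : ∀ r : Fin m → Bool,
      splitWeight m α r * ∏ i ∈ S, (if r i then (1 : ℝ) else 0)
      = ∏ i, ((if r i then α else 1 - α) *
          (if i ∈ S then (if r i then (1 : ℝ) else 0) else 1)) := by
    intro r
    rw [Finset.prod_mul_distrib, splitWeight, Finset.prod_ite_mem, Finset.univ_inter]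
  rw [Finset.sum_congr rfl (fun r _ => h2 r), ← h]
  have h3 : ∀ i : Fin m, (∑ b : Bool, (if b then α else 1 - α) *
      (if i ∈ S then (if b then (1 : ℝ) else 0) else 1)) = if i ∈ S then α else 1 := by
    intro i
    by_cases hi : i ∈ S <;> simp [hi]
  rw [Finset.prod_congr rfl (fun i _ => h3 i), Finset.prod_ite_mem]
  simp

theorem split_moment3 (m : ℕ) (α : ℝ) (i k j : Fin m) :
    ∑ r : Fin m → Bool, splitWeight m α r * ((if r i then (1 : ℝ) else 0) *
        (if r k then (1 : ℝ) else 0) * (if r j then (1 : ℝ) else 0))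
      = α ^ 3 + (α ^ 2 - α ^ 3) * ((if k = i then 1 else 0) + (if k = j then 1 else 0)
          + (if i = j then 1 else 0))
        + (α - 3 * α ^ 2 + 2 * α ^ 3) * (if k = i then (if i = j then 1 else 0) else 0) := by
  have h := split_moment m α {i, k, j}
  have h2 : ∀ r : Fin m → Bool, ∏ l ∈ ({i, k, j} : Finset (Fin m)), (if r l then (1 : ℝ) else 0)
      = (if r i then (1 : ℝ) else 0) * (if r k then (1 : ℝ) else 0) *
        (if r j then (1 : ℝ) else 0) := by
    intro r
    rw [Finset.prod_ite_zero]
    cases hi : r i <;> cases hk : r k <;> cases hj : r j <;> simp [hi, hk, hj]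
  simp only [h2] at h
  rw [h]
  by_cases h1 : k = i
  · subst h1
    by_cases h3 : k = j
    · subst h3
      simp; ring
    · simp [h3]
  · by_cases h3 : k = j
    · subst h3
      simp [h1, Ne.symm h1, Finset.card_pair (Ne.symm h1)]
    · by_cases h4 : i = j
      · subst h4
        have : ({i, k, i} : Finset (Fin m)) = {i, k} := by ext x; simp; tauto
        simp [this, h1, Finset.card_pair (Ne.symm h1)]
      · have : ({i, k, j} : Finset (Fin m)).card = 3 :=
          Finset.card_eq_three.mpr ⟨i, k, j, Ne.symm h1, h4, h3, rfl⟩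
        simp [this, h1, h3, h4]

theorem mask_moment3 (n m : ℕ) (α : ℝ) (i k j : Fin n) (t : Fin n → ℝ)
    (ht : t = fun (i : Fin n) => if (i : ℕ) < m then 1 else 0) (x : (Fin m → Bool) → Fin n → ℝ)
    (hx : x = fun (r : Fin m → Bool) (i : Fin n) => if h : (i : ℕ) < m then (if r ⟨i, h⟩ then (1 : ℝ) else 0) else 0) :
    ∑ r : Fin m → Bool, splitWeight m α r * (x r i * x r k * x r j)
      = t i * t k * t j * (α ^ 3 + (α ^ 2 - α ^ 3) * ((if k = i then 1 else 0)
          + (if k = j then 1 else 0) + (if i = j then 1 else 0))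
        + (α - 3 * α ^ 2 + 2 * α ^ 3) * (if k = i then (if i = j then 1 else 0) else 0)) := by
  subst ht hx
  by_cases hi : (i : ℕ) < m
  · by_cases hk : (k : ℕ) < m
    · by_cases hj : (j : ℕ) < m
      · have h := split_moment3 m α ⟨i, hi⟩ ⟨k, hk⟩ ⟨j, hj⟩
        simp only [Fin.mk.injEq, ← Fin.ext_iff] at h
        simp only [hi, hk, hj, dif_pos, if_true, one_mul]
        exact h
      · simp [hj]
    · simp [hk]
  · simp [hi]

/-- **Cubic-moment identity:**
`E_splits[M_in·Pᵀ·M_in·P·M_in]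
  = α³·P̂ᵀ·P̂ + (α²−α³)·(Ĉ·P̂ + P̂ᵀ·Ĉ) + (α²−α³)·diag(P̂ᵀ·P̂) + (α−3α²+2α³)·Ĉ²`. -/
theorem expectation_min_PT_min_P_min (n m : ℕ) (hm : 1 ≤ m) (hmn : m ≤ n)
    (P : Matrix (Fin n) (Fin n) ℝ) (α : ℝ) (hα0 : 0 < α) (hα1 : α < 1) :
    let Mtr := trainMask n m
    let Phat := Mtr * P * Mtr
    let Chat : Matrix (Fin n) (Fin n) ℝ := Matrix.diagonal fun i => Phat i i
    (∑ r : Fin m → Bool,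
        splitWeight m α r • (inMask n m r * Pᵀ * inMask n m r * P * inMask n m r))
      = α ^ 3 • (Phatᵀ * Phat)
        + (α ^ 2 - α ^ 3) • (Chat * Phat + Phatᵀ * Chat)
        + (α ^ 2 - α ^ 3) • (Matrix.diagonal fun i => (Phatᵀ * Phat) i i)
        + (α - 3 * α ^ 2 + 2 * α ^ 3) • (Chat * Chat) := by
  intro Mtr Phat Chat
  obtain ⟨t, ht⟩ : ∃ t : Fin n → ℝ, t = fun (i : Fin n) => if (i : ℕ) < m then 1 else 0 := ⟨_, rfl⟩
  obtain ⟨x, hx⟩ : ∃ x : (Fin m → Bool) → Fin n → ℝ,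
    x = fun (r : Fin m → Bool) (i : Fin n) => if h : (i : ℕ) < m then (if r ⟨i, h⟩ then 1 else 0) else 0 := ⟨_, rfl⟩
  have htt : ∀ i, t i * t i = t i := by
    intro i; subst ht; by_cases h : (i : ℕ) < m <;> simp [h]
  have hM : ∀ r, inMask n m r = Matrix.diagonal (x r) := by
    intro r; rw [hx]; rfl
  have hP : ∀ i j, Phat i j = t i * P i j * t j := by
    intro i j
    have : Mtr = Matrix.diagonal t := by rw [ht]; rfl
    simp only [Phat, this, Matrix.mul_diagonal, Matrix.diagonal_mul]
  have hPP : ∀ i j, (Phatᵀ * Phat) i j = ∑ k, t i * t k * t j * (P k i * P k j) := by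
    intro i j
    simp only [Matrix.mul_apply, Matrix.transpose_apply, hP]
    refine Finset.sum_congr rfl fun k _ => ?_
    linear_combination (t i * t j * P k i * P k j) * htt k
  have hL : ∀ i j, (∑ r : Fin m → Bool,
      splitWeight m α r • (inMask n m r * Pᵀ * inMask n m r * P * inMask n m r)) i j
      = ∑ k, (P k i * P k j) * ∑ r : Fin m → Bool,
          splitWeight m α r * (x r i * x r k * x r j) := by
    intro i j
    simp only [Matrix.sum_apply, Matrix.smul_apply, hM, Matrix.mul_diagonal, smul_eq_mul]
    simp only [Finset.mul_sum]
    rw [Finset.sum_comm]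
    refine Finset.sum_congr rfl fun r _ => ?_
    simp only [Matrix.mul_apply (N := P), Matrix.mul_diagonal, Matrix.diagonal_mul,
      Matrix.transpose_apply, Finset.sum_mul, Finset.mul_sum]
    refine Finset.sum_congr rfl fun k _ => ?_
    ring
  ext i j
  rw [hL]
  simp only [mask_moment3 n m α i _ j t ht x hx]
  simp only [Matrix.add_apply, Matrix.smul_apply, smul_eq_mul, hPP, Chat, Matrix.diagonal_mul,
    Matrix.mul_diagonal, Matrix.diagonal_apply, hP, Matrix.transpose_apply]
  have e : ∀ k, P k i * P k j * (t i * t k * t j * (α ^ 3 + (α ^ 2 - α ^ 3) *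
      ((if k = i then 1 else 0) + (if k = j then 1 else 0) + (if i = j then 1 else 0))
        + (α - 3 * α ^ 2 + 2 * α ^ 3) * (if k = i then (if i = j then 1 else 0) else 0)))
      = (α ^ 3 + (α ^ 2 - α ^ 3) * (if i = j then 1 else 0)) *
          (t i * t k * t j * (P k i * P k j))
        + (if k = i then (α ^ 2 - α ^ 3 + (α - 3 * α ^ 2 + 2 * α ^ 3) *
            (if i = j then 1 else 0)) * (t i * t k * t j * (P k i * P k j)) else 0)
        + (if k = j then (α ^ 2 - α ^ 3) * (t i * t k * t j * (P k i * P k j)) else 0) := by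
    intro k
    split_ifs <;> ring
  simp only [e, Finset.sum_add_distrib, ← Finset.mul_sum, Finset.sum_ite_eq', Finset.mem_univ,
    if_true]
  by_cases hij : i = j
  · subst hij
    simp only [htt, if_true]
    have h2 : t i * P i i * t i = t i * P i i := by linear_combination P i i * htt i
    simp only [h2]
    linear_combination (-(α - α ^ 2)) * (P i i) ^ 2 * htt i
  · simp only [hij, if_false]
    linear_combination (-(α ^ 2 - α ^ 3)) * (P i i * P i j * t j * t i * htt i + P j i * P j j * t i * t j * htt j)
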